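/- arXiv:1207.1138 — 2 statements merged into one kernel-verified Lean document; each statement's English description precedes it below -/
import Mathlib

section
/- Let p ≡ 1 (mod 6) be a prime of the form p = 4t² + 27 and let α be a primitive root modulo p such that if 3 ≡ α^x (mod p) then x ≡ 1 (mod 6). Then the set {α^i : i ≡ 0, 1, or 3 (mod 6)} is a cyclic difference set DS(p, (p−1)/2, (p−3)/4) in Z_p (a Hall difference set). -/
open Finset

section JacobiSum

variable {F R : Type*} [Field F] [Fintype F] [CommRing R]

/-- A character evaluated along `x ↦ s - x`: the Jacobi sum scaled to an arbitrary sum `s ≠ 0`. -/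
theorem sum_mulChar_mul_sub (A B : MulChar F R) {s : F} (hs : s ≠ 0) :
    ∑ x, A x * B (s - x) = (A * B) s * jacobiSum A B := by
  rw [jacobiSum, ← Equiv.sum_comp (Equiv.mulLeft₀ s hs), mul_sum]
  refine sum_congr rfl fun x _ ↦ ?_
  have : s - s * x = s * (1 - x) := by ring
  simp only [Equiv.mulLeft₀_apply, this, map_mul, MulChar.mul_apply]
  ring

theorem sum_mulChar_mul_neg (A B : MulChar F R) :
    ∑ x, A x * B (0 - x) = B (-1) * ∑ x, (A * B) x := by
  rw [mul_sum]
  refine sum_congr rfl fun x _ ↦ ?_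
  have : 0 - x = -1 * x := by ring
  rw [this, map_mul, MulChar.mul_apply]
  ring

theorem sum_mulChar_add (A B : MulChar F R) {d : F} (hd : d ≠ 0) :
    ∑ x, A (x + d) * B x = B (-1) * (A * B) d * jacobiSum A B := by
  rw [mul_assoc, ← sum_mulChar_mul_sub A B hd,
    ← Equiv.sum_comp (Equiv.addRight d) fun x ↦ A x * B (d - x), mul_sum]
  refine sum_congr rfl fun x _ ↦ ?_
  have h : d - (x + d) = -1 * x := by ring
  have h1 : B (-1) * B (-1) = 1 := by rw [← map_mul]; simp
  simp only [Equiv.coe_addRight, h, map_mul]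
  linear_combination -(A (x + d) * B x) * h1

/-- The Jacobi sum of three characters in terms of ordinary Jacobi sums. -/
theorem sum_sum_mulChar (A B C : MulChar F R) :
    ∑ x, ∑ y, A x * B y * C (1 - x - y) =
      jacobiSum B C * jacobiSum A (B * C) + C (-1) * ∑ y, (B * C) y := by
  classical
  have key : ∀ x : F, ∑ y, A x * B y * C (1 - x - y) =
      jacobiSum B C * (A x * (B * C) (1 - x)) +
        if x = 1 then C (-1) * ∑ y, (B * C) y else 0 := by
    intro x
    simp only [mul_assoc, ← mul_sum]
    split_ifs with hx
    · subst hx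
      rw [sub_self, sum_mulChar_mul_neg, MulChar.map_zero]
      simp
    · rw [sum_mulChar_mul_sub _ _ (sub_ne_zero.2 (Ne.symm hx))]
      ring
  simp only [key, sum_add_distrib, ← mul_sum, sum_ite_eq', mem_univ, if_true]
  rfl

/-- The Jacobi sum transforms simply under `x ↦ x / (x - 1)`. -/
theorem jacobiSum_eq_of_mul_mul_eq_one {A B C : MulChar F R} (h : A * B * C = 1) :
    jacobiSum A B = A (-1) * jacobiSum A C := by
  classical
  have hsplit : ∀ D : MulChar F R, jacobiSum A D = ∑ x ∈ univ.erase 1, A x * D (1 - x) := by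
    intro D
    rw [jacobiSum, ← add_sum_erase _ _ (mem_univ (1 : F)), sub_self, D.map_zero, mul_zero,
      zero_add]
  rw [hsplit B, hsplit C, mul_sum]
  have hinv : ∀ x : F, x ≠ 1 → x / (x - 1) ≠ 1 ∧ x / (x - 1) / (x / (x - 1) - 1) = x := by
    intro x hx
    have hx' : x - 1 ≠ 0 := sub_ne_zero.2 hx
    have h1 : x / (x - 1) - 1 = 1 / (x - 1) := by field_simp; ring
    refine ⟨fun h0 ↦ ?_, ?_⟩
    · rw [h0, sub_self] at h1
      exact one_div_ne_zero hx' h1.symm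
    · rw [h1]; field_simp
  refine sum_nbij' (fun x ↦ x / (x - 1)) (fun x ↦ x / (x - 1)) ?_ ?_ ?_ ?_ ?_
  · intro x hx; simpa using (hinv x (by simpa using hx)).1
  · intro x hx; simpa using (hinv x (by simpa using hx)).1
  · intro x hx; exact (hinv x (by simpa using hx)).2
  · intro x hx; exact (hinv x (by simpa using hx)).2
  intro x hx
  have hx' : x - 1 ≠ 0 := sub_ne_zero.2 (by simpa using hx)
  have h1 : 1 - x / (x - 1) = -1 * (x - 1)⁻¹ := by field_simp; ring
  have h2 : (1 - x) = -1 * (x - 1) := by ring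
  have hu : IsUnit (1 - x) := isUnit_iff_ne_zero.2 (by rw [h2]; exact mul_ne_zero (by simp) hx')
  have h3 : A (1 - x) * B (1 - x) * C (1 - x) = 1 := by
    rw [← MulChar.mul_apply, ← MulChar.mul_apply, h, MulChar.one_apply hu]
  have h4 : x = -1 * (x / (x - 1)) * (1 - x) := by field_simp; ring
  have h5 : A x = A (-1) * A (x / (x - 1)) * A (1 - x) := by
    rw [← map_mul, ← map_mul, ← h4]
  have h6 : C (1 - x) * C (1 - x / (x - 1)) = 1 := by
    rw [← map_mul, show (1 - x) * (1 - x / (x - 1)) = 1 by field_simp; ring, map_one]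
  rw [h5]
  linear_combination A (-1) * A (x / (x - 1)) *
    (C (1 - x / (x - 1)) * h3 - A (1 - x) * B (1 - x) * h6)

/-- The duplication formula for Jacobi sums. -/
theorem apply_four_mul_jacobiSum_self [DecidableEq F] [IsDomain R] (hF : ringChar F ≠ 2)
    {A η : MulChar F R} (hA : A ≠ 1) (hη : ∀ x, η x = ((quadraticChar F x : ℤ) : R)) :
    A 4 * jacobiSum A A = jacobiSum A η := by
  have h2 : (2 : F) ≠ 0 := Ring.two_ne_zero hF
  have e1 : A 4 * jacobiSum A A = ∑ y : F, A (1 - y ^ 2) := by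
    rw [jacobiSum, mul_sum,
      ← ((Equiv.mulLeft₀ (2 : F) h2).trans (Equiv.subRight (1 : F))).sum_comp (fun y ↦ A (1 - y ^ 2))]
    refine sum_congr rfl fun x _ ↦ ?_
    simp only [Equiv.trans_apply, Equiv.mulLeft₀_apply, Equiv.subRight_apply, ← map_mul]
    congr 1
    ring
  have e2 : ∀ u : F, ((#{y : F | y ^ 2 = u} : ℕ) : R) = η u + 1 := by
    intro u
    have := quadraticChar_card_sqrts hF u
    rw [hη, ← Int.cast_one (R := R), ← Int.cast_add, ← this, Int.cast_natCast]
    congr 2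
    ext; simp
  rw [e1, ← sum_fiberwise univ (fun y : F ↦ y ^ 2), jacobiSum_comm, jacobiSum]
  have e3 : ∀ u : F, ∑ y with y ^ 2 = u, A (1 - y ^ 2) = η u * A (1 - u) + A (1 - u) := by
    intro u
    rw [sum_congr rfl (g := fun _ ↦ A (1 - u)) (by simp +contextual), sum_const, nsmul_eq_mul, e2]
    ring
  simp only [e3, sum_add_distrib]
  have e4 : ∑ u, A (1 - u) = ∑ u, A u := (Equiv.subLeft (1 : F)).sum_comp (fun u ↦ A u)
  rw [e4, MulChar.sum_eq_zero_of_ne_one hA, add_zero]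

/-- `jacobiSum_mul_jacobiSum_inv` for characters with values in a domain. -/
theorem jacobiSum_mul_jacobiSum_of_mul_eq_one [IsDomain R] [CharZero R] {A B A' B' : MulChar F R}
    (hA : A ≠ 1) (hB : B ≠ 1) (hAB : A * B ≠ 1) (hA' : A * A' = 1) (hB' : B * B' = 1) :
    jacobiSum A B * jacobiSum A' B' = Fintype.card F := by
  let f := algebraMap R (FractionRing R)
  have hf : Function.Injective f := IsFractionRing.injective R (FractionRing R)
  have hne : ∀ C : MulChar F R, C ≠ 1 → C.ringHomComp f ≠ 1 := fun C hC ↦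
    (MulChar.ringHomComp_ne_one_iff hf).2 hC
  have hmul : ∀ C D : MulChar F R,
      C.ringHomComp f * D.ringHomComp f = (C * D).ringHomComp f := by
    intro C D; ext; simp
  have hinv : ∀ C D : MulChar F R, C * D = 1 → D.ringHomComp f = (C.ringHomComp f)⁻¹ := by
    intro C D h
    rw [eq_inv_iff_mul_eq_one, mul_comm, hmul, h, MulChar.ringHomComp_one]
  apply hf
  have : CharZero (FractionRing R) := charZero_of_injective_algebraMap hf
  rw [map_mul, ← jacobiSum_ringHomComp, ← jacobiSum_ringHomComp, hinv _ _ hA', hinv _ _ hB',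
    jacobiSum_mul_jacobiSum_inv ?_ (hne _ hA) (hne _ hB) ?_, map_natCast]
  · rw [ringChar.eq_zero]
    exact (CharP.char_ne_zero_of_finite F (ringChar F)).symm
  · rw [hmul]; exact hne _ hAB

end JacobiSum

/-- Sum of a function invariant under a permutation of prime order, modulo that prime. -/
theorem Equiv.Perm.exists_sum_eq_sum_fixed_add {X R : Type*} [Fintype X] [DecidableEq X]
    [CommRing R] [DecidableEq R] (q : ℕ) [Fact q.Prime] (σ : Equiv.Perm X) (hσ : σ ^ q = 1)
    (f : X → R) (hf : ∀ x, f (σ x) = f x) :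
    ∃ z : R, ∑ x, f x = ∑ x with σ x = x, f x + q * z := by
  have hcard : ∀ v : R, ∃ k : ℤ,
      (#{x | f x = v} : ℤ) = #{x | σ x = x ∧ f x = v} + q * k := by
    intro v
    let τ : Equiv.Perm {x // f x = v} := σ.subtypePerm fun x ↦ by rw [hf]
    have hτ : τ ^ q ^ 1 = 1 := by
      ext x
      simp [τ, Equiv.Perm.subtypePerm_pow, hσ]
    have h := (Equiv.Perm.card_compl_support_modEq hτ).dvd
    have hfix : #(τ.supportᶜ) = #{x | σ x = x ∧ f x = v} := by
      refine card_bij (fun x _ ↦ x.1) ?_ (fun _ _ _ _ ↦ Subtype.ext) ?_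
      · rintro ⟨x, hx⟩ h
        simpa [τ, hx, Subtype.ext_iff] using h
      · intro x hx
        simp only [mem_filter, mem_univ, true_and] at hx
        exact ⟨⟨x, hx.2⟩, by simp [τ, hx.1], rfl⟩
    rw [Fintype.card_subtype, hfix] at h
    obtain ⟨k, hk⟩ := h
    exact ⟨k, by linarith⟩
  choose k hk using hcard
  have hfib : ∀ s : Finset X, ∑ x ∈ s, f x = ∑ v ∈ univ.image f, (#{x ∈ s | f x = v} : R) * v := by
    intro s
    rw [← sum_fiberwise_of_maps_to (t := univ.image f) (g := f) (by simp)]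
    refine sum_congr rfl fun v _ ↦ ?_
    rw [sum_congr rfl (g := fun _ ↦ v) (by simp), sum_const, nsmul_eq_mul]
  refine ⟨∑ v ∈ univ.image f, (k v : R) * v, ?_⟩
  rw [hfib univ, hfib {x | σ x = x}, mul_sum, ← sum_add_distrib]
  refine sum_congr rfl fun v _ ↦ ?_
  have := congrArg (Int.cast (R := R)) (hk v)
  push_cast at this
  rw [this, filter_filter]
  ring

section EvenTwist

variable {F R : Type*} [Field F] [Fintype F] [CommRing R]

theorem exists_jacobiSum_self_eq_add_two_mul (hF : ringChar F ≠ 2) (A : MulChar F R) :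
    ∃ z, jacobiSum A A = A 2⁻¹ ^ 2 + 2 * z := by
  classical
  have h2 : (2 : F) ≠ 0 := Ring.two_ne_zero hF
  obtain ⟨z, hz⟩ := Equiv.Perm.exists_sum_eq_sum_fixed_add 2 (Equiv.subLeft (1 : F))
    (by ext x; simp [pow_two]) (fun x ↦ A x * A (1 - x)) (fun x ↦ by simp [mul_comm])
  refine ⟨z, ?_⟩
  have hfix : ({x | (Equiv.subLeft (1 : F)) x = x} : Finset F) = {2⁻¹} := by
    ext x
    simp only [Equiv.subLeft_apply, mem_filter, mem_univ, true_and, mem_singleton]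
    rw [← mul_eq_one_iff_eq_inv₀ h2]
    constructor <;> intro h <;> linear_combination -h
  rw [jacobiSum, hz, hfix, sum_singleton, show (1 : F) - 2⁻¹ = 2⁻¹ by field_simp; norm_num]
  push_cast
  ring

end EvenTwist

/-- The ring of Eisenstein integers `a + b ω`, where `ω ^ 2 + ω + 1 = 0`. -/
abbrev EisensteinInt := QuadraticAlgebra ℤ (-1) (-1)

namespace EisensteinInt

instance : NoZeroDivisors EisensteinInt where
  eq_zero_or_eq_zero_of_mul_eq_zero {x y} h := by
    have key : ∀ z : EisensteinInt, z.norm = 0 → z = 0 := by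
      intro z hz
      rw [QuadraticAlgebra.norm_def] at hz
      have h1 : z.im = 0 := by nlinarith [sq_nonneg (2 * z.re - z.im), sq_nonneg z.im]
      have h2 : z.re = 0 := by rw [h1] at hz; nlinarith [sq_nonneg z.re]
      exact QuadraticAlgebra.ext h2 h1
    have := congrArg QuadraticAlgebra.norm h
    rw [map_mul, QuadraticAlgebra.norm_zero, mul_eq_zero] at this
    exact this.imp (key x) (key y)

instance : IsDomain EisensteinInt := NoZeroDivisors.to_isDomain _

/-- The values of a cubic character. -/
def cubicValues : Finset EisensteinInt := {0, 1, ⟨0, 1⟩, ⟨-1, -1⟩}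

/-- The values of a sextic character. -/
def sexticValues : Finset EisensteinInt :=
  {0, 1, ⟨0, 1⟩, ⟨-1, -1⟩, -1, ⟨0, -1⟩, ⟨1, 1⟩}

theorem mem_cubicValues_of_pow_three {v : EisensteinInt} (h : v ^ 3 = 1) : v ∈ cubicValues := by
  have h1 : (v - 1) * ((v - ⟨0, 1⟩) * (v - ⟨-1, -1⟩)) = 0 := by
    have e1 : (⟨0, 1⟩ + ⟨-1, -1⟩ : EisensteinInt) = -1 := by decide
    have e2 : (⟨0, 1⟩ * ⟨-1, -1⟩ : EisensteinInt) = 1 := by decide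
    linear_combination h - (v - 1) * v * e1 + (v - 1) * e2
  rcases mul_eq_zero.1 h1 with h | h
  · simp [sub_eq_zero.1 h, cubicValues]
  rcases mul_eq_zero.1 h with h | h
  · simp [sub_eq_zero.1 h, cubicValues]
  · simp [sub_eq_zero.1 h, cubicValues]

theorem mem_sexticValues_of_pow_six {v : EisensteinInt} (h : v ^ 6 = 1) : v ∈ sexticValues := by
  have h1 : (v ^ 3 - 1) * ((-v) ^ 3 - 1) = 0 := by linear_combination -h
  rcases mul_eq_zero.1 h1 with h | h
  · have := mem_cubicValues_of_pow_three (sub_eq_zero.1 h)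
    revert this
    generalize v = w
    simp only [cubicValues, sexticValues, mem_insert, mem_singleton]
    tauto
  · have := mem_cubicValues_of_pow_three (sub_eq_zero.1 h)
    rw [← neg_neg v]
    revert this
    generalize -v = w
    revert w
    decide

theorem nine_mul_diagonal : ∀ u ∈ cubicValues, ∀ v ∈ cubicValues, ∀ w ∈ cubicValues,
    9 * (if u = v ∧ v = w then u ^ 2 else 0) =
      (u ^ 2 * v ^ 3 * w ^ 3 + u ^ 3 * v * w + u * v ^ 2 * w ^ 2) +
      (v ^ 2 * w ^ 3 * u ^ 3 + v ^ 3 * w * u + v * w ^ 2 * u ^ 2) +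
      (w ^ 2 * u ^ 3 * v ^ 3 + w ^ 3 * u * v + w * u ^ 2 * v ^ 2) := by
  decide

/-- Six times the indicator function of `{1, ζ, ζ ^ 3}` on the sixth roots of unity, as a linear
combination of powers. -/
theorem six_mul_indicator : ∀ v ∈ sexticValues,
    6 * (if v = 1 ∨ v = ⟨1, 1⟩ ∨ v = -1 then 1 else 0 : EisensteinInt) =
      3 * v ^ 6 + ⟨0, -1⟩ * v + ⟨1, -1⟩ * v ^ 2 - v ^ 3 + ⟨2, 1⟩ * v ^ 4 + ⟨1, 1⟩ * v ^ 5 := by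
  decide

end EisensteinInt

section Cubic

open EisensteinInt

variable {F : Type*} [Field F] [Fintype F]

/-- The Jacobi sum of a cubic character modulo `9` is determined by the cubic character of `3`. -/
theorem exists_jacobiSum_cubic_eq_add_nine_mul [DecidableEq F] (hF : (3 : F) ≠ 0)
    {ψ : MulChar F EisensteinInt} (h3 : ψ ^ 3 = 1) (hψ : ψ ≠ 1) :
    ∃ z, jacobiSum ψ ψ = 1 + Fintype.card F - 3 * ψ 3 + 9 * z := by
  have hψ2 : ψ ^ 2 ≠ 1 := fun h ↦ hψ (by rw [← h3, pow_succ, h, one_mul])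
  have hval : ∀ x, ψ x ∈ cubicValues := by
    intro x
    by_cases hx : x = 0
    · rw [hx, ψ.map_zero]
      simp [cubicValues]
    · apply mem_cubicValues_of_pow_three
      rw [← MulChar.pow_apply' _ (by norm_num), h3, MulChar.one_apply (isUnit_iff_ne_zero.2 hx)]
  let σ : Equiv.Perm (F × F) :=
    ⟨fun q ↦ (q.2, 1 - q.1 - q.2), fun q ↦ (1 - q.1 - q.2, q.1),
      fun q ↦ by ext <;> simp, fun q ↦ Prod.ext (by simp) (by simp; ring)⟩
  have hσ : ∀ q, σ q = (q.2, 1 - q.1 - q.2) := fun _ ↦ rfl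
  have hσ3 : σ ^ 3 = 1 := by
    ext q
    · simp [pow_succ, hσ]
    · simp only [pow_succ, pow_zero, one_mul, Equiv.Perm.mul_apply, hσ, Equiv.Perm.one_apply]
      ring
  let g : F × F → EisensteinInt := fun q ↦
    ψ q.1 ^ 2 * ψ q.2 ^ 3 * ψ (1 - q.1 - q.2) ^ 3 + ψ q.1 ^ 3 * ψ q.2 * ψ (1 - q.1 - q.2) +
      ψ q.1 * ψ q.2 ^ 2 * ψ (1 - q.1 - q.2) ^ 2
  let w : F × F → EisensteinInt := fun q ↦
    if ψ q.1 = ψ q.2 ∧ ψ q.2 = ψ (1 - q.1 - q.2) then ψ q.1 ^ 2 else 0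
  have hrot : ∀ q : F × F, 1 - q.2 - (1 - q.1 - q.2) = q.1 := fun q ↦ by ring
  have hw : ∀ q, w (σ q) = w q := by
    intro q
    simp only [w, hσ, hrot]
    split_ifs <;> simp_all
  have hwg : ∀ q, 9 * w q = g q + g (σ q) + g (σ (σ q)) := by
    intro q
    have h := nine_mul_diagonal _ (hval q.1) _ (hval q.2) _ (hval (1 - q.1 - q.2))
    have hrot' : 1 - (1 - q.1 - q.2) - q.1 = q.2 := by ring
    simp only [w, g, hσ, hrot, hrot']
    exact h
  have hsum : 3 * ∑ q, w q = ∑ q, g q := by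
    have h9 : 9 * ∑ q, w q = 3 * ∑ q, g q := by
      rw [mul_sum, sum_congr rfl fun q _ ↦ hwg q, sum_add_distrib, sum_add_distrib,
        Equiv.sum_comp σ g, Equiv.sum_comp σ (fun q ↦ g (σ q)), Equiv.sum_comp σ g]
      ring
    exact mul_left_cancel₀ (by norm_num : (3 : EisensteinInt) ≠ 0) (by linear_combination h9)
  have hg : ∑ q, g q = 1 - jacobiSum ψ ψ + Fintype.card F := by
    have e1 : ∀ x, ψ x ^ 3 = (1 : MulChar F EisensteinInt) x := fun x ↦ by
      rw [← MulChar.pow_apply' _ (by norm_num), h3]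
    have e2 : ∀ x, ψ x ^ 2 = (ψ ^ 2) x := fun x ↦ by rw [MulChar.pow_apply' _ (by norm_num)]
    have e4 : ψ ^ 2 * ψ ^ 2 = ψ := by
      rw [← pow_add, show 2 + 2 = 3 + 1 from rfl, pow_succ, h3, one_mul]
    have m3 : ψ * ψ ^ 2 = 1 := by rw [← pow_succ', h3]
    simp only [g, e1, e2, sum_add_distrib, Fintype.sum_prod_type, sum_sum_mulChar]
    rw [e4, one_mul, ← pow_two, jacobiSum_comm (ψ ^ 2) 1, jacobiSum_one_nontrivial hψ2,
      jacobiSum_one_one, MulChar.sum_eq_zero_of_ne_one hψ,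
      MulChar.sum_eq_zero_of_ne_one hψ2, mul_comm (jacobiSum (ψ ^ 2) (ψ ^ 2)),
      jacobiSum_mul_jacobiSum_of_mul_eq_one hψ hψ (by rwa [← pow_two]) m3 m3,
      MulChar.sum_one_eq_card_units, Fintype.card_units, Nat.cast_sub Fintype.card_pos,
      MulChar.one_apply (by simp)]
    push_cast
    ring
  obtain ⟨z, hz⟩ := Equiv.Perm.exists_sum_eq_sum_fixed_add 3 σ hσ3 w hw
  have hfix : ({q | σ q = q} : Finset (F × F)) = {(3⁻¹, 3⁻¹)} := by
    ext ⟨x, y⟩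
    simp only [hσ, mem_filter, mem_univ, true_and, mem_singleton, Prod.mk.injEq]
    rw [← mul_eq_one_iff_eq_inv₀ hF, ← mul_eq_one_iff_eq_inv₀ hF]
    constructor
    · rintro ⟨h1, h2⟩
      subst h1
      constructor <;> linear_combination -h2
    · rintro ⟨h1, h2⟩
      have : x = y := mul_right_cancel₀ hF (h1.trans h2.symm)
      subst this
      exact ⟨rfl, by linear_combination -h1⟩
  have hw3 : w (3⁻¹, 3⁻¹) = ψ 3 := by
    have h1 : (1 : F) - 3⁻¹ - 3⁻¹ = 3⁻¹ := by field_simp; norm_num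
    have h2 : ψ 3 * ψ 3⁻¹ = 1 := by rw [← map_mul, mul_inv_cancel₀ hF, map_one]
    have h3' : ψ 3⁻¹ ^ 3 = 1 := by
      rw [← MulChar.pow_apply' _ (by norm_num), h3, MulChar.one_apply]
      simpa using hF
    simp only [w, h1, and_self, if_true]
    linear_combination ψ 3 * h3' - ψ 3⁻¹ ^ 2 * h2
  rw [hfix, sum_singleton, hw3] at hz
  refine ⟨-z, ?_⟩
  push_cast at hz
  linear_combination hsum + hg - 3 * hz

end Cubic

theorem cubic_parameter_eq_six {p : ℕ} (hp : p.Prime) {t a b : ℤ} (hpt : (p : ℤ) = 4 * t ^ 2 + 27)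
    (hab : a ^ 2 - a * b + b ^ 2 = p) (hb : b % 9 = 6) : b = 6 := by
  obtain ⟨m, rfl⟩ : ∃ m, b = 3 * m := ⟨b / 3, by omega⟩
  have hm : m % 3 = 2 := by omega
  have hp' : Prime (p : ℤ) := Nat.prime_iff_prime_int.1 hp
  have hp0 : (0 : ℤ) < p := by exact_mod_cast hp.pos
  have key : ∀ s : ℤ, s ^ 2 = t ^ 2 → (p : ℤ) ∣ 2 * a - 3 * m - 2 * s * m → m = 2 := by
    rintro s hs ⟨k, hk⟩
    have h1 : (2 * s * (2 * a - 3 * m) + 27 * m) ^ 2 + 27 * (p * k) ^ 2 = 4 * (p : ℤ) ^ 2 := by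
      rw [← hk]
      have h4 : (2 * a - 3 * m) ^ 2 + 27 * m ^ 2 = 4 * (p : ℤ) := by linear_combination 4 * hab
      have h5 : (p : ℤ) = 4 * s ^ 2 + 27 := by rw [hs, hpt]
      linear_combination (4 * s ^ 2 + 27) * h4 - 4 * (p : ℤ) * h5
    have hk0 : k = 0 := by
      by_contra hk0
      have : 1 ≤ k ^ 2 := by have := sq_pos_of_ne_zero hk0; omega
      nlinarith [sq_nonneg (2 * s * (2 * a - 3 * m) + 27 * m), mul_pos hp0 hp0]
    rw [hk0, mul_zero] at hk
    have hm4 : (p : ℤ) * (m ^ 2 - 4) = 0 := by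
      linear_combination m ^ 2 * hpt - 4 * m ^ 2 * hs + 4 * hab -
        (2 * a - 3 * m + 2 * s * m) * hk
    rcases mul_eq_zero.1 hm4 with h | h
    · omega
    · have : (m - 2) * (m + 2) = 0 := by linear_combination h
      rcases mul_eq_zero.1 this with h | h <;> omega
  have hdvd : (p : ℤ) ∣ (2 * a - 3 * m - 2 * t * m) * (2 * a - 3 * m - 2 * (-t) * m) :=
    ⟨4 - m ^ 2, by linear_combination 4 * hab + m ^ 2 * hpt⟩
  have := (hp'.dvd_or_dvd hdvd).elim (key t rfl) (key (-t) (by ring))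
  omega

namespace EisensteinInt

theorem re_ofNat (n : ℕ) [n.AtLeastTwo] : (ofNat(n) : EisensteinInt).re = ofNat(n) := rfl

theorem im_ofNat (n : ℕ) [n.AtLeastTwo] : (ofNat(n) : EisensteinInt).im = 0 := rfl

theorem im_one : (1 : EisensteinInt).im = 0 := rfl

theorem eq_one_of_pow_three_eq_one : ∀ v ∈ cubicValues, v ^ 3 = 1 → v.im % 2 = 0 → v = 1 := by
  decide

theorem sextic_apply_mem {F : Type*} [Field F] {χ : MulChar F EisensteinInt} (h6 : χ ^ 6 = 1)
    (x : F) : χ x ∈ sexticValues := by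
  by_cases hx : x = 0
  · rw [hx, χ.map_zero]
    simp [sexticValues]
  · apply mem_sexticValues_of_pow_six
    rw [← MulChar.pow_apply' _ (by norm_num), h6, MulChar.one_apply (isUnit_iff_ne_zero.2 hx)]

end EisensteinInt

open EisensteinInt in
/-- Hall difference sets: let `p ≡ 1 (mod 6)` be a prime of the form
`p = 4t² + 27` and `α` a primitive root modulo `p` such that whenever
`3 = α^x` one has `x ≡ 1 (mod 6)`.  Then `{α^i : i ≡ 0, 1, 3 (mod 6)}` is a
cyclic difference set `DS(p, (p−1)/2, (p−3)/4)` in `ℤ/pℤ`. -/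
theorem hall_difference_set (p : ℕ) (t : ℕ) [Fact p.Prime] (hp6 : p % 6 = 1)
    (hpt : p = 4 * t ^ 2 + 27) (α : (ZMod p)ˣ)
    (hα : ∀ g : (ZMod p)ˣ, ∃ n : ℕ, α ^ n = g)
    (h3 : ∀ x : ℕ, (α : ZMod p) ^ x = 3 → x % 6 = 1) :
    let B : Finset (ZMod p) :=
      ((Finset.range (p - 1)).filter
        (fun i => i % 6 = 0 ∨ i % 6 = 1 ∨ i % 6 = 3)).image
        (fun i => (α : ZMod p) ^ i)
    B.card = (p - 1) / 2 ∧
    ∀ d : ZMod p, d ≠ 0 →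
      ((B ×ˢ B).filter (fun q => q.1 ≠ q.2 ∧ q.1 - q.2 = d)).card = (p - 3) / 4 := by
  intro B
  have hp : p.Prime := Fact.out
  have hg : ∀ x, x ∈ Subgroup.zpowers α := fun x ↦ by
    obtain ⟨n, rfl⟩ := hα x
    exact Subgroup.npow_mem_zpowers α n
  have hcard : Fintype.card (ZMod p) = p := ZMod.card p
  have hchar : ringChar (ZMod p) ≠ 2 := by rw [ZMod.ringChar_zmod_n]; omega
  have h30 : (3 : ZMod p) ≠ 0 := by
    intro h
    have : ((3 : ℕ) : ZMod p) = 0 := by exact_mod_cast h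
    rw [ZMod.natCast_eq_zero_iff] at this
    have := Nat.le_of_dvd (by norm_num) this
    omega
  -- the sextic character sending `α` to `1 + ω`
  let ζ : EisensteinIntˣ := ⟨⟨1, 1⟩, ⟨0, -1⟩, by decide, by decide⟩
  have hζ6 : ζ ^ 6 = 1 := Units.ext (by decide)
  have hζ : ζ ∈ rootsOfUnity (Fintype.card (ZMod p)ˣ) EisensteinInt := by
    rw [mem_rootsOfUnity, ZMod.card_units, show p - 1 = 6 * (p / 6) by omega, pow_mul, hζ6, one_pow]
  let χ : MulChar (ZMod p) EisensteinInt := MulChar.ofRootOfUnity hζ hg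
  have hχα : χ α = ⟨1, 1⟩ := MulChar.ofRootOfUnity_spec hζ hg
  clear_value χ
  have hpow : ∀ (k : ℕ), (χ ^ k) α = ⟨1, 1⟩ ^ k := fun k ↦ by rw [MulChar.pow_apply_coe, hχα]
  have hχ6 : χ ^ 6 = 1 := by
    rw [MulChar.eq_iff hg, hpow, MulChar.one_apply_coe]; decide
  have hne : ∀ k, k ∈ Ioo 0 6 → χ ^ k ≠ 1 := by
    intro k hk h
    rw [MulChar.eq_iff hg, hpow, MulChar.one_apply_coe] at h
    revert k; decide
  have hη : ∀ x, (χ ^ 3) x = ((quadraticChar (ZMod p) x : ℤ) : EisensteinInt) := by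
    have : χ ^ 3 = (quadraticChar (ZMod p)).ringHomComp (Int.castRingHom EisensteinInt) := by
      rw [MulChar.eq_iff hg, hpow, MulChar.ringHomComp_apply]
      have : quadraticChar (ZMod p) α = -1 := by
        rw [quadraticChar_eq_neg_one_iff_not_one α.ne_zero]
        intro h
        exact quadraticChar_ne_one hchar ((MulChar.eq_iff hg _ _).2 (by
          rw [h, MulChar.one_apply_coe]))
      rw [this]
      decide
    intro x
    rw [this]
    rfl
  have hneg3 : (χ ^ 3) (-1) = -1 := by
    rw [hη, quadraticChar_neg_one hchar, hcard, ZMod.χ₄_nat_three_mod_four (by omega)]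
    rfl
  have hneg : χ (-1) = -1 := by
    have h2 : χ (-1) * χ (-1) = 1 := by rw [← map_mul]; simp
    rw [MulChar.pow_apply' _ (by norm_num)] at hneg3
    linear_combination hneg3 - χ (-1) * h2
  have hψ3 : (χ ^ 2) 3 = ⟨0, 1⟩ := by
    obtain ⟨n, hn⟩ := hα (Units.mk0 3 h30)
    have hn' : (α : ZMod p) ^ n = 3 := by rw [← Units.val_pow_eq_pow_val, hn]; rfl
    have hn6 := h3 n hn'
    have h6 : (⟨1, 1⟩ : EisensteinInt) ^ 6 = 1 := by decide
    rw [← hn', map_pow, hpow, ← Nat.div_add_mod n 6, hn6, ← pow_mul, mul_comm, pow_mul,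
      pow_add, pow_mul, h6, one_pow]
    decide
  set P := jacobiSum (χ ^ 2) (χ ^ 2) with hP
  set Q := jacobiSum (χ ^ 4) (χ ^ 4) with hQ
  have hstar : Q = star P := by
    have : (χ ^ 2).ringHomComp (starRingEnd EisensteinInt) = χ ^ 4 := by
      rw [MulChar.eq_iff hg, MulChar.ringHomComp_apply, hpow, hpow]
      decide
    rw [hQ, ← this, jacobiSum_ringHomComp]
    rfl
  obtain ⟨z, hz⟩ := exists_jacobiSum_cubic_eq_add_nine_mul (ψ := χ ^ 2) h30
    (by rw [← pow_mul, hχ6]) (hne 2 (by decide))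
  obtain ⟨z', hz'⟩ := exists_jacobiSum_self_eq_add_two_mul hchar (χ ^ 2)
  rw [← hP] at hz hz'
  have hPim : P.im = 6 := by
    refine cubic_parameter_eq_six hp (t := t) (a := P.re) (by exact_mod_cast hpt) ?_ ?_
    · have h1 : P * Q = Fintype.card (ZMod p) :=
        jacobiSum_mul_jacobiSum_of_mul_eq_one (hne 2 (by decide)) (hne 2 (by decide))
          (by rw [← pow_add]; exact hne 4 (by decide)) (by rw [← pow_add, hχ6])
          (by rw [← pow_add, hχ6])
      have h2 := congrArg QuadraticAlgebra.re h1
      rw [hstar, hcard] at h2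
      simp at h2
      linear_combination h2
    · have := congrArg QuadraticAlgebra.im hz
      rw [hψ3] at this
      simp [re_ofNat, im_ofNat, im_one] at this
      omega
  have h20 : (2 : ZMod p) ≠ 0 := Ring.two_ne_zero hchar
  have hχ2 : χ 2 ^ 2 = 1 := by
    have e1 : χ 2 * χ 2⁻¹ = 1 := by rw [← map_mul, mul_inv_cancel₀ h20, map_one]
    have e2 : ∀ x : ZMod p, x ≠ 0 → χ x ^ 6 = 1 := fun x hx ↦ by
      rw [← MulChar.pow_apply' _ (by norm_num), hχ6, MulChar.one_apply (isUnit_iff_ne_zero.2 hx)]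
    have e3 : (χ 2⁻¹ ^ 4) ^ 3 = 1 := by
      rw [← pow_mul, show 4 * 3 = 6 * 2 from rfl, pow_mul, e2 _ (inv_ne_zero h20), one_pow]
    have e4 := mem_cubicValues_of_pow_three e3
    have e5 : (χ 2⁻¹ ^ 4).im % 2 = 0 := by
      have := congrArg QuadraticAlgebra.im hz'
      rw [MulChar.pow_apply' _ (by norm_num), ← pow_mul, QuadraticAlgebra.im_add, hPim] at this
      simp [re_ofNat, im_ofNat] at this
      omega
    have e6 : χ 2⁻¹ ^ 4 = 1 := eq_one_of_pow_three_eq_one _ e4 e3 e5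
    have e7 : χ 2 ^ 4 = 1 := by
      have : (χ 2 * χ 2⁻¹) ^ 4 = 1 := by rw [e1, one_pow]
      rwa [mul_pow, e6, mul_one] at this
    linear_combination e2 2 h20 - χ 2 ^ 2 * e7
  have hχ4 : ∀ k ≠ 0, (χ ^ k) 4 = 1 := by
    intro k hk
    rw [MulChar.pow_apply' _ hk, show (4 : ZMod p) = 2 ^ 2 by norm_num, map_pow, hχ2, one_pow]
  -- evaluation of the Jacobi sums
  have hdup : ∀ k ∈ Ioo 0 6, jacobiSum (χ ^ k) (χ ^ k) = jacobiSum (χ ^ k) (χ ^ 3) := by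
    intro k hk
    rw [← apply_four_mul_jacobiSum_self hchar (hne k hk) hη, hχ4 k (by simp at hk; omega), one_mul]
  have hrefl : ∀ i j, 3 + i + j = 6 ∨ 3 + i + j = 12 →
      jacobiSum (χ ^ i) (χ ^ 3) = -jacobiSum (χ ^ j) (χ ^ 3) := by
    intro i j hij
    rw [jacobiSum_comm, jacobiSum_eq_of_mul_mul_eq_one (C := χ ^ j), hneg3, jacobiSum_comm (χ ^ 3)]
    · ring
    · rw [← pow_add, ← pow_add]
      rcases hij with h | h
      · rw [h, hχ6]
      · rw [h, show 12 = 6 * 2 from rfl, pow_mul, hχ6, one_pow]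
  have J13 : jacobiSum (χ ^ 1) (χ ^ 3) = -P := by
    rw [hrefl 1 2 (by norm_num), hP, hdup 2 (by decide)]
  have J53 : jacobiSum (χ ^ 5) (χ ^ 3) = -Q := by
    rw [hrefl 5 4 (by norm_num), hQ, hdup 4 (by decide)]
  have J11 : jacobiSum (χ ^ 1) (χ ^ 1) = -P := by rw [hdup 1 (by decide), J13]
  have J55 : jacobiSum (χ ^ 5) (χ ^ 5) = -Q := by rw [hdup 5 (by decide), J53]
  have J00 : jacobiSum (χ ^ 0) (χ ^ 0) = (p : EisensteinInt) - 2 := by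
    rw [pow_zero, jacobiSum_one_one, hcard]
  have J0 : ∀ k ∈ Ioo 0 6, jacobiSum (χ ^ 0) (χ ^ k) = -1 := fun k hk ↦ by
    rw [pow_zero, jacobiSum_one_nontrivial (hne k hk)]
  have Jinv : ∀ i j, i ∈ Ioo 0 6 → i + j = 6 → jacobiSum (χ ^ i) (χ ^ j) = -(-1) ^ i := by
    intro i j hi hij
    have : χ ^ j = (χ ^ i)⁻¹ := by rw [eq_inv_iff_mul_eq_one, ← pow_add, add_comm, hij, hχ6]
    rw [this, jacobiSum_nontrivial_inv (hne i hi), MulChar.pow_apply' _ (by simp at hi; omega),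
      hneg]
  -- the indicator function of `B` as a combination of characters
  let ω : EisensteinInt := ⟨0, 1⟩
  have hω : ω ^ 2 + ω + 1 = 0 := by decide
  let c : ℕ → EisensteinInt := fun i ↦
    if i = 0 then 3 else if i = 1 then -ω else if i = 2 then 1 - ω else if i = 3 then -1 else
      if i = 4 then 2 + ω else 1 + ω
  let f : ZMod p → EisensteinInt := fun x ↦ if x ∈ B then 1 else 0
  have hmem : ∀ x, x ∈ B ↔ (χ x = 1 ∨ χ x = ⟨1, 1⟩ ∨ χ x = -1) := by
    have hzpow : ∀ n : ℕ, χ ((α : ZMod p) ^ n) = ⟨1, 1⟩ ^ (n % 6) := by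
      intro n
      have h6 : (⟨1, 1⟩ : EisensteinInt) ^ 6 = 1 := by decide
      rw [map_pow, hχα]
      conv_lhs => rw [← Nat.div_add_mod n 6, pow_add, pow_mul, h6, one_pow, one_mul]
    have hval : ∀ m < 6, (m = 0 ∨ m = 1 ∨ m = 3) ↔ ((⟨1, 1⟩ : EisensteinInt) ^ m = 1 ∨
        (⟨1, 1⟩ : EisensteinInt) ^ m = ⟨1, 1⟩ ∨ (⟨1, 1⟩ : EisensteinInt) ^ m = -1) := by
      decide
    intro x
    simp only [B, mem_image, mem_filter, mem_range]
    constructor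
    · rintro ⟨i, ⟨-, hi⟩, rfl⟩
      rw [hzpow]
      exact (hval _ (Nat.mod_lt _ (by norm_num))).1 hi
    · intro h
      have hx : x ≠ 0 := by
        rintro rfl
        rw [χ.map_zero] at h
        revert h
        decide
      obtain ⟨n, hn⟩ := hα (Units.mk0 x hx)
      have hn' : (α : ZMod p) ^ n = x := by rw [← Units.val_pow_eq_pow_val, hn]; rfl
      refine ⟨n % (p - 1), ⟨Nat.mod_lt _ (by have := hp.two_le; omega), ?_⟩, ?_⟩
      · rw [Nat.mod_mod_of_dvd _ (by omega), hval _ (Nat.mod_lt _ (by norm_num)), ← hzpow, hn']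
        exact h
      · have h1 : (α : ZMod p) ^ (p - 1) = 1 := ZMod.pow_card_sub_one_eq_one α.ne_zero
        rw [← hn']
        conv_rhs => rw [← Nat.div_add_mod n (p - 1), pow_add, pow_mul, h1, one_pow, one_mul]
  have hf : ∀ x, 6 * f x = ∑ i ∈ range 6, c i * (χ ^ i) x := by
    intro x
    have h := six_mul_indicator _ (sextic_apply_mem hχ6 x)
    rw [← MulChar.pow_apply' _ (by norm_num), hχ6] at h
    have e1 : (⟨0, -1⟩ : EisensteinInt) = -ω := by decide
    have e2 : (⟨1, -1⟩ : EisensteinInt) = 1 - ω := by decide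
    have e4 : (⟨2, 1⟩ : EisensteinInt) = 2 + ω := by decide
    have e5 : (⟨1, 1⟩ : EisensteinInt) = 1 + ω := by decide
    simp only [f, hmem, h, sum_range_succ, range_zero, sum_empty, pow_zero,
      MulChar.pow_apply' _ (one_ne_zero), MulChar.pow_apply' _ (two_ne_zero),
      MulChar.pow_apply' _ (three_ne_zero), MulChar.pow_apply' _ (four_ne_zero),
      MulChar.pow_apply' _ (show 5 ≠ 0 by norm_num)]
    simp only [c, e1, e2, e4]
    norm_num
    rw [e5]
    ring
  constructor
  · have hB : (#B : EisensteinInt) = ∑ x, f x := by simp [f]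
    have h6 : 6 * (#B : EisensteinInt) = 3 * ((p - 1 : ℕ) : EisensteinInt) := by
      rw [hB, mul_sum, sum_congr rfl fun x _ ↦ hf x, sum_comm]
      simp only [← mul_sum]
      rw [sum_range_succ', sum_eq_zero, zero_add, pow_zero, MulChar.sum_one_eq_card_units,
        ZMod.card_units]
      · rfl
      · intro i hi
        rw [MulChar.sum_eq_zero_of_ne_one (hne _ (by simp at hi ⊢; omega)), mul_zero]
    have : 6 * #B = 3 * (p - 1) := by exact_mod_cast h6
    omega
  intro d hd
  set N := #{q ∈ B ×ˢ B | q.1 ≠ q.2 ∧ q.1 - q.2 = d} with hN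
  have hNf : (N : EisensteinInt) = ∑ x, f (x + d) * f x := by
    have : N = #{x | x + d ∈ B ∧ x ∈ B} := by
      refine card_nbij' (fun q ↦ q.2) (fun x ↦ (x + d, x)) ?_ ?_ ?_ ?_
      · rintro ⟨a, b⟩ h
        simp only [mem_product, coe_filter, Set.mem_ofPred_eq, mem_univ,
          true_and] at h ⊢
        rw [← h.2.2]
        simpa using h.1
      · intro x h
        simp only [mem_product, coe_filter, Set.mem_ofPred_eq, mem_univ,
          true_and] at h ⊢
        simpa [hd] using h
      · rintro ⟨a, b⟩ h
        simp only [mem_product, coe_filter, Set.mem_ofPred_eq] at h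
        simp [← h.2.2]
      · intro x _
        rfl
    rw [this]
    simp only [f, ← ite_and, mul_ite, mul_one, mul_zero, sum_boole, and_comm]
  have hexp : 36 * (N : EisensteinInt) = ∑ i ∈ range 6, ∑ j ∈ range 6,
      c i * c j * ((-1) ^ j * χ d ^ (i + j) * jacobiSum (χ ^ i) (χ ^ j)) := by
    have hpd : ∀ i x, x ≠ 0 → (χ ^ i) x = χ x ^ i := fun i x hx ↦ by
      rw [← Units.val_mk0 hx, MulChar.pow_apply_coe]
    calc 36 * (N : EisensteinInt) = ∑ x, (6 * f (x + d)) * (6 * f x) := by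
          rw [hNf, mul_sum]
          exact sum_congr rfl fun x _ ↦ by ring
      _ = ∑ x, ∑ i ∈ range 6, ∑ j ∈ range 6, c i * c j * ((χ ^ i) (x + d) * (χ ^ j) x) := by
          refine sum_congr rfl fun x _ ↦ ?_
          rw [hf, hf, sum_mul_sum]
          exact sum_congr rfl fun i _ ↦ sum_congr rfl fun j _ ↦ by ring
      _ = _ := by
          rw [sum_comm]
          refine sum_congr rfl fun i _ ↦ ?_
          rw [sum_comm]
          refine sum_congr rfl fun j _ ↦ ?_
          rw [← mul_sum, sum_mulChar_add _ _ hd, ← pow_add, hpd _ _ hd,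
            hpd _ _ (by simp : (-1 : ZMod p) ≠ 0), hneg]
  have hd6 : χ d ^ 6 = 1 := by
    rw [← MulChar.pow_apply' _ (by norm_num), hχ6, MulChar.one_apply (isUnit_iff_ne_zero.2 hd)]
  have hPω : P = (P.re : EisensteinInt) + 6 * ω := by
    ext <;> simp [ω, hPim, re_ofNat, im_ofNat]
  have hQω : Q = (P.re : EisensteinInt) - 6 - 6 * ω := by
    rw [hstar]
    ext <;> simp [ω, hPim, re_ofNat, im_ofNat]
    ring
  have h36 : 36 * (N : EisensteinInt) = 9 * ((p : EisensteinInt) - 3) := by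
    rw [hexp]
    simp only [sum_range_succ, range_zero, sum_empty]
    rw [J00, jacobiSum_comm (χ ^ 1) (χ ^ 0), jacobiSum_comm (χ ^ 2) (χ ^ 0),
      jacobiSum_comm (χ ^ 3) (χ ^ 0), jacobiSum_comm (χ ^ 4) (χ ^ 0),
      jacobiSum_comm (χ ^ 5) (χ ^ 0), jacobiSum_comm (χ ^ 2) (χ ^ 1),
      jacobiSum_comm (χ ^ 3) (χ ^ 1), jacobiSum_comm (χ ^ 4) (χ ^ 1),
      jacobiSum_comm (χ ^ 3) (χ ^ 2), jacobiSum_comm (χ ^ 5) (χ ^ 2),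
      jacobiSum_comm (χ ^ 4) (χ ^ 3), jacobiSum_comm (χ ^ 3) (χ ^ 5),
      jacobiSum_comm (χ ^ 5) (χ ^ 4), J0 1 (by decide), J0 2 (by decide), J0 3 (by decide),
      J0 4 (by decide), J0 5 (by decide), Jinv 1 5 (by decide) rfl, Jinv 5 1 (by decide) rfl,
      Jinv 2 4 (by decide) rfl, Jinv 4 2 (by decide) rfl, Jinv 3 3 (by decide) rfl, J11, J13,
      J53, J55, ← hP, ← hQ, hPω, hQω]
    have e8 : χ d ^ 8 = χ d ^ 2 := by linear_combination χ d ^ 2 * hd6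
    have e10 : χ d ^ 10 = χ d ^ 4 := by linear_combination χ d ^ 4 * hd6
    simp only [Nat.reduceAdd, hd6, e8, e10]
    simp only [c]
    norm_num
    linear_combination (4 + (2 * (P.re : EisensteinInt) - 18) * (χ d ^ 2 + χ d ^ 4)) * hω
  have hp3 : 36 * (N : EisensteinInt) + 27 = 9 * p := by rw [h36]; ring
  have : 36 * N + 27 = 9 * p := by exact_mod_cast hp3
  omega
end

section
/- For any prime power q and any integer m ≥ 2, there exists a cyclic difference set DS(v, k, μ) in Z_v with v = (q^{m+1} − 1)/(q − 1), k = (q^m − 1)/(q − 1), and μ = (q^{m−1} − 1)/(q − 1); consequently there exists an optimal self-synchronizing (v, k, ρ)-quantum tag with ρ = 2(q^m − q^{m−1})/(q − 1). -/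
/-- The image in `Kˣ ⧸ Fˣ` of the nonzero vectors of an `F`-subspace of `K`. -/
def unitClasses {F K : Type*} [Field F] [Field K] [Algebra F K] (W : Submodule F K) :
    Set (Kˣ ⧸ (Units.map (algebraMap F K : F →* K)).range) :=
  QuotientGroup.mk '' {u : Kˣ | (u : K) ∈ W}

section UnitClasses

variable {F K : Type*} [Field F] [Field K] [Algebra F K]

theorem mk_mem_unitClasses {W : Submodule F K} {u : Kˣ} :
    (QuotientGroup.mk u : Kˣ ⧸ (Units.map (algebraMap F K : F →* K)).range) ∈ unitClasses W ↔
      (u : K) ∈ W := by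
  refine ⟨?_, fun h => ⟨u, h, rfl⟩⟩
  rintro ⟨w, hw, hwu⟩
  obtain ⟨c, hc⟩ := QuotientGroup.eq.mp hwu
  obtain rfl : u = w * Units.map (algebraMap F K : F →* K) c := by rw [hc]; group
  have := W.smul_mem (c : F) hw
  rw [Algebra.smul_def, mul_comm] at this
  simpa using this

theorem natCard_unitClasses [Finite F] [Finite K] (W : Submodule F K) :
    Nat.card (unitClasses W) * (Nat.card F - 1) = Nat.card F ^ Module.finrank F W - 1 := by
  have hH : Nat.card (Units.map (algebraMap F K : F →* K)).range = Nat.card F - 1 := by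
    rw [← Nat.card_units]
    exact (Nat.card_congr (MonoidHom.ofInjective
      (Units.map_injective (algebraMap F K).injective)).toEquiv).symm
  have hpre : Nat.card (QuotientGroup.mk ⁻¹' unitClasses W : Set Kˣ) =
      Nat.card F ^ Module.finrank F W - 1 := by
    have e : (QuotientGroup.mk ⁻¹' unitClasses W : Set Kˣ) ≃ {w : W // w ≠ 0} :=
      { toFun u := ⟨⟨u.1, mk_mem_unitClasses.mp u.2⟩, by simp [← Subtype.coe_inj]⟩
        invFun w := ⟨Units.mk0 w.1 (by simpa using w.2), mk_mem_unitClasses.mpr (by simp)⟩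
        left_inv u := by ext; simp
        right_inv w := by ext; simp }
    rw [Nat.card_congr e, ← Module.natCard_eq_pow_finrank]
    classical
    have := Fintype.ofFinite W
    simp [Nat.card_eq_fintype_card, Fintype.card_subtype_compl]
  rw [← hpre, Nat.card_congr (QuotientGroup.preimageMkEquivSubgroupProdSet _ _), Nat.card_prod,
    hH, mul_comm]

theorem finrank_ker_inf_ker_add_two [FiniteDimensional F K] {L : Module.Dual F K} (hL : L ≠ 0)
    {a : K} (ha : a ∉ (algebraMap F K).range) :
    Module.finrank F
      (LinearMap.ker L ⊓ LinearMap.ker (L ∘ₗ LinearMap.mulLeft F a) : Submodule F K) + 2 =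
      Module.finrank F K := by
  set M : Module.Dual F K := L ∘ₗ LinearMap.mulLeft F a
  have hM : M.domRestrict (LinearMap.ker L) ≠ 0 := by
    intro h
    have hle : ⨅ _ : Unit, LinearMap.ker L ≤ LinearMap.ker M := by
      intro x hx
      simpa using LinearMap.congr_fun h ⟨x, by simpa using hx⟩
    have hs := mem_span_of_iInf_ker_le_ker (L := fun _ : Unit => L) hle
    rw [Set.range_const, Submodule.mem_span_singleton] at hs
    obtain ⟨c, hc⟩ := hs
    obtain ⟨x, hx⟩ := DFunLike.ne_iff.mp hL
    have hne : a - algebraMap F K c ≠ 0 := fun h0 => ha ⟨c, (sub_eq_zero.mp h0).symm⟩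
    apply hx
    have h1 := LinearMap.congr_fun hc ((a - algebraMap F K c)⁻¹ * x)
    have h2 : a * ((a - algebraMap F K c)⁻¹ * x) =
        x + c • ((a - algebraMap F K c)⁻¹ * x) := by
      rw [Algebra.smul_def]; field_simp; ring
    simp only [M, LinearMap.smul_apply, LinearMap.comp_apply, LinearMap.mulLeft_apply, h2, map_add,
      map_smul] at h1
    simpa using h1
  have h1 := Module.Dual.finrank_ker_add_one_of_ne_zero hL
  have h2 := Module.Dual.finrank_ker_add_one_of_ne_zero (f := M.domRestrict (LinearMap.ker L)) hM
  have h3 : Module.finrank F (LinearMap.ker (M.domRestrict (LinearMap.ker L))) =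
      Module.finrank F (LinearMap.ker L ⊓ LinearMap.ker M : Submodule F K) := by
    rw [LinearMap.ker_domRestrict, ← Submodule.map_comap_subtype, Submodule.finrank_map_subtype_eq]
  omega

/-- Singer's construction, with the cardinalities multiplied by `#F - 1`. -/
theorem exists_singer_set_of_finrank [Finite F] [Finite K] {m v : ℕ}
    (hK : Module.finrank F K = m + 1) (hv : v * (Nat.card F - 1) = Nat.card F ^ (m + 1) - 1) :
    ∃ B : Finset (ZMod v), B.card * (Nat.card F - 1) = Nat.card F ^ m - 1 ∧
      ∀ d : ZMod v, d ≠ 0 →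
        {a ∈ B | a - d ∈ B}.card * (Nat.card F - 1) = Nat.card F ^ (m - 1) - 1 := by
  classical
  let Q := Kˣ ⧸ (Units.map (algebraMap F K : F →* K)).range
  have hQ : Nat.card Q = v := by
    have h := natCard_unitClasses (⊤ : Submodule F K)
    have htop : unitClasses (⊤ : Submodule F K) = Set.univ := by
      ext y
      obtain ⟨u, rfl⟩ := QuotientGroup.mk_surjective y
      simp [mk_mem_unitClasses]
    rw [finrank_top, hK, htop, ← hv, Nat.card_congr (Equiv.Set.univ _)] at h
    exact Nat.eq_of_mul_eq_mul_right (Nat.sub_pos_of_lt Finite.one_lt_card) h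
  have : NeZero v := ⟨hQ ▸ Nat.card_pos.ne'⟩
  obtain ⟨g, hg⟩ := IsCyclic.exists_generator (α := Q)
  let e : Multiplicative (ZMod v) ≃* Q := zmodMulEquivOfGenerator hg hQ
  let f : ZMod v ≃ Q := Multiplicative.ofAdd.trans e.toEquiv
  have hcard (s : Set Q) : {i : ZMod v | f i ∈ s}.toFinset.card = Nat.card s := by
    rw [Set.toFinset_card, ← Nat.card_eq_fintype_card]
    exact Nat.card_congr (f.subtypeEquiv fun _ => Iff.rfl)
  obtain ⟨L, hL⟩ := exists_ne (0 : Module.Dual F K)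
  refine ⟨{i : ZMod v | f i ∈ unitClasses (LinearMap.ker L)}.toFinset, ?_, fun d hd => ?_⟩
  · have h := natCard_unitClasses (LinearMap.ker L)
    have hk := Module.Dual.finrank_ker_add_one_of_ne_zero hL
    rw [hcard, h, show Module.finrank F (LinearMap.ker L) = m by omega]
  · obtain ⟨a, ha⟩ := QuotientGroup.mk_surjective (f (-d))
    have haF : (a : K) ∉ (algebraMap F K).range := by
      rintro ⟨c, hc⟩
      have hc0 : c ≠ 0 := by rintro rfl; exact a.ne_zero (by rw [← hc, map_zero])
      have h1 : f (-d) = f 0 := by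
        rw [← ha]
        have ha1 : a ∈ (Units.map (algebraMap F K : F →* K)).range :=
          ⟨Units.mk0 c hc0, Units.ext hc⟩
        exact ((QuotientGroup.eq_one_iff a).mpr ha1).trans (map_one e).symm
      exact hd (neg_eq_zero.mp (f.injective h1))
    have hk := finrank_ker_inf_ker_add_two hL haF
    have h := natCard_unitClasses
      (LinearMap.ker L ⊓ LinearMap.ker (L ∘ₗ LinearMap.mulLeft F (a : K)))
    rw [← hcard, show Module.finrank F _ = m - 1 from by omega] at h
    rw [← h]
    congr 2
    ext i
    obtain ⟨u, hu⟩ := QuotientGroup.mk_surjective (f i)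
    have hi : f (i - d) = QuotientGroup.mk (a * u) := by
      rw [QuotientGroup.mk_mul, ha, hu, sub_eq_neg_add]
      exact map_mul e _ _
    simp only [Finset.mem_filter, Set.mem_toFinset, Set.mem_ofPred_eq, hi, ← hu]
    exact (and_congr mk_mem_unitClasses mk_mem_unitClasses).trans
      (.trans (by simp) mk_mem_unitClasses.symm)

end UnitClasses

theorem exists_singer_set {q m v : ℕ} (hq : IsPrimePow q)
    (hv : v * (q - 1) = q ^ (m + 1) - 1) :
    ∃ B : Finset (ZMod v), B.card * (q - 1) = q ^ m - 1 ∧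
      ∀ d : ZMod v, d ≠ 0 → {a ∈ B | a - d ∈ B}.card * (q - 1) = q ^ (m - 1) - 1 := by
  obtain ⟨p, n, hp, hn, rfl⟩ := hq
  have := Fact.mk hp.nat_prime
  have hF : Nat.card (GaloisField p n) = p ^ n := GaloisField.card p n hn.ne'
  rw [← hF] at hv ⊢
  exact exists_singer_set_of_finrank
    (FiniteField.finrank_extension (GaloisField p n) p (m + 1)) hv

/-- For any prime power `q` and any `m ≥ 2`, there exists a cyclic difference
set `DS(v,k,μ)` with `v = (q^{m+1}−1)/(q−1)`, `k = (q^m−1)/(q−1)`,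
`μ = (q^{m−1}−1)/(q−1)`; consequently there exists an optimal
self-synchronizing `(v,k,ρ)`-quantum tag with `ρ = 2(q^m − q^{m−1})/(q−1)`. -/
theorem singer_difference_set_and_optimal_tag (q m : ℕ) (hq : IsPrimePow q)
    (hm : 2 ≤ m) :
    let v := (q ^ (m + 1) - 1) / (q - 1)
    let k := (q ^ m - 1) / (q - 1)
    let μ := (q ^ (m - 1) - 1) / (q - 1)
    let ρ := 2 * (q ^ m - q ^ (m - 1)) / (q - 1)
    (∃ B : Finset (ZMod v), B.card = k ∧ 0 < μ ∧ μ < k ∧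
        ∀ d : ZMod v, d ≠ 0 →
          ((B ×ˢ B).filter (fun pr => pr.1 ≠ pr.2 ∧ pr.1 - pr.2 = d)).card = μ) ∧
    (∃ T : Finset (ZMod v), T.card = k ∧ 1 ≤ ρ ∧
        (∀ t : ZMod v, t ≠ 0 →
          ρ ≤ (T ∪ T.image (· + t)).card - (T ∩ T.image (· + t)).card) ∧
        ρ = 2 * k * (v - k) / (v - 1)) := by
  intro v k μ ρ
  have hq2 : 2 ≤ q := hq.two_le
  have hq0 : 0 < q - 1 := by omega
  have hgeom (n : ℕ) : (q ^ n - 1) / (q - 1) * (q - 1) = q ^ n - 1 :=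
    Nat.div_mul_cancel (Nat.sub_one_dvd_pow_sub_one q n)
  obtain ⟨B, hB, hd⟩ := exists_singer_set (v := v) hq (hgeom (m + 1))
  have hBk : B.card = k := Nat.eq_div_of_mul_eq_left hq0.ne' hB
  replace hd (d : ZMod v) (h : d ≠ 0) : {a ∈ B | a - d ∈ B}.card = μ :=
    Nat.eq_div_of_mul_eq_left hq0.ne' (hd d h)
  obtain ⟨n, rfl⟩ : ∃ n, m = n + 1 := ⟨m - 1, by omega⟩
  have hsucc (j : ℕ) : (q ^ (j + 1) - 1) / (q - 1) = (q ^ j - 1) / (q - 1) + q ^ j := by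
    rw [← Nat.geomSum_eq hq2, ← Nat.geomSum_eq hq2, Finset.sum_range_succ]
  have hsucc' (j : ℕ) : (q ^ (j + 1) - 1) / (q - 1) = q * ((q ^ j - 1) / (q - 1)) + 1 := by
    rw [← Nat.geomSum_eq hq2, ← Nat.geomSum_eq hq2, geom_sum_succ]
  have hk : k = μ + q ^ n := hsucc n
  have hvk : v = k + q ^ (n + 1) := hsucc (n + 1)
  have hvk' : v = q * k + 1 := hsucc' (n + 1)
  have hpow : 0 < q ^ n := by positivity
  have hμ : 0 < μ := by
    obtain ⟨j, rfl⟩ : ∃ j, n = j + 1 := ⟨n - 1, by omega⟩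
    exact (Nat.succ_pos _).trans_eq (hsucc' j).symm
  have hρ : ρ = 2 * q ^ n := by
    refine Nat.div_eq_of_eq_mul_left hq0 ?_
    rw [Nat.add_sub_cancel, pow_succ, mul_assoc, Nat.mul_sub_one]
  refine ⟨⟨B, hBk, hμ, by omega, fun d hd0 => ?_⟩, B, hBk, by omega, fun t ht => ?_, ?_⟩
  · rw [← hd d hd0]
    refine Finset.card_bij' (fun pr _ => pr.1) (fun a _ => (a, a - d)) ?_ ?_ ?_ ?_
    · rintro ⟨a, b⟩ h
      simp only [Finset.mem_filter, Finset.mem_product] at h ⊢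
      exact ⟨h.1.1, by rw [← h.2.2, sub_sub_cancel]; exact h.1.2⟩
    · intro a h
      simp only [Finset.mem_filter, Finset.mem_product] at h ⊢
      exact ⟨h, fun h' => hd0 (by simpa using sub_eq_self.mp h'.symm), sub_sub_cancel a d⟩
    · rintro ⟨a, b⟩ h
      simp only [Finset.mem_filter] at h
      simp [← h.2.2]
    · simp
  · have hinter : B ∩ B.image (· + t) = {a ∈ B | a - t ∈ B} := by
      ext a
      simp [sub_eq_add_neg]
    have hcard := Finset.card_union_add_card_inter B (B.image (· + t))
    rw [Finset.card_image_of_injective _ (add_left_injective t)] at hcard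
    rw [hinter, hd t ht] at hcard ⊢
    exact Nat.le_sub_of_add_le (by omega)
  · rw [hρ, show v - k = q ^ n * q by rw [hvk, Nat.add_sub_cancel_left, pow_succ],
      show v - 1 = q * k by omega]
    refine (Nat.div_eq_of_eq_mul_left (Nat.mul_pos (by omega) (by omega)) ?_).symm
    ring
end
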